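/- Let n ≥ 2 and F = (x_1^2 + x_2^2 + x_3^2)(y_1^2 + ... + y_n^2). Then the Waring rank of F is at most 6n. Concretely, the ideal I = ({Y_iY_j}_{1≤i<j≤n}, X_1X_2, X_1X_3, X_2^2 − X_3^2, X_1^2 − X_2^2 + Y_1^2 + ... + Y_{n-1}^2 − (n−1)Y_n^2) is contained in F^⊥ and is the radical ideal of 6n distinct points of ℙ^{n+2}. -/

import Mathlib

open MvPolynomial
open scoped Classical

/-- Differentiation of `F` by the monomial with exponent vector `m`:
`∂^m F`, defined coefficientwise via descending factorials. -/
noncomputable def contract {σ : Type*} (m : σ →₀ ℕ) (F : MvPolynomial σ ℂ) : MvPolynomial σ ℂ :=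
  ∑ k ∈ F.support, monomial (k - m) (F.coeff k * m.prod fun i e => (Nat.descFactorial (k i) e : ℂ))

/-- The apolarity (differentiation) action: `apolar g F = g ∘ F`. -/
noncomputable def apolar {σ : Type*} (g F : MvPolynomial σ ℂ) : MvPolynomial σ ℂ :=
  ∑ m ∈ g.support, g.coeff m • contract m F

/-- Homogeneous vanishing ideal of a set of projective points: all polynomials
vanishing on the corresponding lines through the origin. -/
noncomputable def projVanishingIdeal {σ : Type*} (S : Set (Projectivization ℂ (σ → ℂ))) :
    Ideal (MvPolynomial σ ℂ) :=
  ⨅ P ∈ S, ⨅ c : ℂ, RingHom.ker (MvPolynomial.eval (c • P.rep))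

/-- The Waring rank of a degree-`d` form `F`: the least `r` such that `F` is a
linear combination of `r` `d`-th powers of linear forms. -/
noncomputable def waringRank {σ : Type*} [Fintype σ] (d : ℕ) (F : MvPolynomial σ ℂ) : ℕ :=
  sInf {r | ∃ c : Fin r → ℂ, ∃ L : Fin r → σ → ℂ,
    F = ∑ i, MvPolynomial.C (c i) * (∑ j, MvPolynomial.C (L i j) * X j) ^ d}

section Apolarity

variable {σ : Type*}

lemma apolar_eq_sum_of_subset {g : MvPolynomial σ ℂ} (F : MvPolynomial σ ℂ)
    {T : Finset (σ →₀ ℕ)} (hT : g.support ⊆ T) :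
    apolar g F = ∑ m ∈ T, g.coeff m • contract m F := by
  refine Finset.sum_subset hT fun m _ hm => ?_
  rw [notMem_support_iff.mp hm, zero_smul]

lemma apolar_add (g h F : MvPolynomial σ ℂ) :
    apolar (g + h) F = apolar g F + apolar h F := by
  rw [apolar_eq_sum_of_subset F (T := g.support ∪ h.support) support_add,
    apolar_eq_sum_of_subset F (g := g) Finset.subset_union_left,
    apolar_eq_sum_of_subset F (g := h) Finset.subset_union_right, ← Finset.sum_add_distrib]
  simp only [coeff_add, add_smul]

lemma apolar_zero (F : MvPolynomial σ ℂ) : apolar 0 F = 0 := by simp [apolar]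

lemma apolar_monomial (m : σ →₀ ℕ) (a : ℂ) (F : MvPolynomial σ ℂ) :
    apolar (monomial m a) F = a • contract m F := by
  rw [apolar_eq_sum_of_subset F support_monomial_subset]
  simp

lemma apolar_smul (a : ℂ) (g F : MvPolynomial σ ℂ) : apolar (a • g) F = a • apolar g F := by
  rw [apolar_eq_sum_of_subset F (support_smul (a := a) (f := g)), apolar, Finset.smul_sum]
  simp only [coeff_smul, smul_assoc]

/-- For a fixed form `F`, the action `g ↦ g ∘ F` as a linear map. -/
noncomputable def apolarLinear (F : MvPolynomial σ ℂ) :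
    MvPolynomial σ ℂ →ₗ[ℂ] MvPolynomial σ ℂ where
  toFun g := apolar g F
  map_add' g h := apolar_add g h F
  map_smul' a g := apolar_smul a g F

lemma apolar_one (F : MvPolynomial σ ℂ) : apolar 1 F = F := by
  rw [show (1 : MvPolynomial σ ℂ) = monomial 0 1 from rfl, apolar_monomial, one_smul]
  simp [contract, support_sum_monomial_coeff]

lemma contract_add_single [Fintype σ] (m : σ →₀ ℕ) (i : σ) (F : MvPolynomial σ ℂ) :
    contract (m + Finsupp.single i 1) F = pderiv i (contract m F) := by
  simp only [contract, map_sum, pderiv_monomial]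
  refine Finset.sum_congr rfl fun k _ => ?_
  rw [tsub_add_eq_tsub_tsub, mul_assoc]
  congr 2
  rw [Finsupp.prod_fintype _ _ (by simp), Finsupp.prod_fintype _ _ (by simp),
    ← Finset.mul_prod_erase _ _ (Finset.mem_univ i),
    ← Finset.mul_prod_erase (Finset.univ) (fun j => ((k j).descFactorial (m j) : ℂ))
      (Finset.mem_univ i)]
  have : ∏ j ∈ Finset.univ.erase i, ((k j).descFactorial ((m + Finsupp.single i 1 : σ →₀ ℕ) j) : ℂ)
      = ∏ j ∈ Finset.univ.erase i, ((k j).descFactorial (m j) : ℂ) := by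
    refine Finset.prod_congr rfl fun j hj => ?_
    simp [Finsupp.single_eq_of_ne (Finset.ne_of_mem_erase hj)]
  rw [this]
  simp only [Finsupp.coe_add, Pi.add_apply, Finsupp.single_eq_same, Nat.descFactorial_succ,
    Nat.cast_mul, Finsupp.coe_tsub, Pi.sub_apply]
  ring

lemma apolar_X_mul [Fintype σ] (i : σ) (g F : MvPolynomial σ ℂ) :
    apolar (X i * g) F = pderiv i (apolar g F) := by
  induction g using MvPolynomial.induction_on' with
  | monomial m a =>
    rw [mul_comm, X, monomial_mul, mul_one, apolar_monomial, apolar_monomial, contract_add_single,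
      Derivation.map_smul]
  | add p q hp hq => rw [mul_add, apolar_add, apolar_add, map_add, hp, hq]

/-- The annihilator of a form under the apolarity action. -/
noncomputable def apolarIdeal [Fintype σ] (F : MvPolynomial σ ℂ) :
    Ideal (MvPolynomial σ ℂ) where
  carrier := {g | apolar g F = 0}
  add_mem' {g h} hg hh := by
    simp only [Set.mem_ofPred_eq] at *
    rw [apolar_add, hg, hh, add_zero]
  zero_mem' := apolar_zero F
  smul_mem' f g hg := by
    simp only [Set.mem_ofPred_eq, smul_eq_mul] at *
    induction f using MvPolynomial.induction_on with
    | C a => rw [C_mul', apolar_smul, hg, smul_zero]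
    | add p q hp hq => rw [add_mul, apolar_add, hp, hq, add_zero]
    | mul_X p i hp => rw [mul_comm p, mul_assoc, apolar_X_mul, hp, map_zero]

lemma mem_apolarIdeal [Fintype σ] {g F : MvPolynomial σ ℂ} :
    g ∈ apolarIdeal F ↔ apolar g F = 0 := Iff.rfl

lemma apolar_X_mul_X [Fintype σ] (i j : σ) (F : MvPolynomial σ ℂ) :
    apolar (X i * X j) F = pderiv i (pderiv j F) := by
  rw [apolar_X_mul, ← mul_one (X j), apolar_X_mul, apolar_one]

end Apolarity

section VanishingIdeal

variable {σ : Type*}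

lemma mem_projVanishingIdeal {S : Set (Projectivization ℂ (σ → ℂ))} {f : MvPolynomial σ ℂ} :
    f ∈ projVanishingIdeal S ↔ ∀ P ∈ S, ∀ c : ℂ, eval (c • P.rep) f = 0 := by
  simp [projVanishingIdeal, RingHom.mem_ker]

lemma mem_projVanishingIdeal_range {κ : Type*} (v : κ → σ → ℂ) (hv : ∀ k, v k ≠ 0)
    {f : MvPolynomial σ ℂ} :
    f ∈ projVanishingIdeal (Set.range fun k => Projectivization.mk ℂ (v k) (hv k)) ↔
      ∀ k, ∀ c : ℂ, eval (c • v k) f = 0 := by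
  rw [mem_projVanishingIdeal, Set.forall_mem_range]
  refine forall_congr' fun k => ?_
  obtain ⟨a, ha⟩ := Projectivization.exists_smul_eq_mk_rep ℂ (v k) (hv k)
  rw [← ha]
  refine ⟨fun h c => ?_, fun h c => ?_⟩
  · have := h (c * (a : ℂ)⁻¹)
    rwa [Units.smul_def, smul_smul, inv_mul_cancel_right₀ a.ne_zero] at this
  · rw [Units.smul_def, smul_smul]
    exact h _

end VanishingIdeal

section ThreeLines

/-- The ideal of three concurrent lines in `ℂ³`. -/
noncomputable def threeLinesIdeal : Ideal (MvPolynomial (Fin 3) ℂ) :=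
  Ideal.span {X 0 * X 1, X 0 * X 2, X 1 ^ 2 - X 2 ^ 2}

/-- Direction vectors of the lines cut out by `threeLinesIdeal`. -/
def lineDir : Fin 3 → Fin 3 → ℂ := ![![1, 0, 0], ![0, 1, 1], ![0, 1, -1]]

lemma exists_normalForm_threeLines (f : MvPolynomial (Fin 3) ℂ) :
    ∃ u v w : Polynomial ℂ,
      f - (X 0 * Polynomial.aeval (X 0) u + Polynomial.aeval (X 1) v +
        X 2 * Polynomial.aeval (X 1) w) ∈ threeLinesIdeal := by
  have h01 : (X 0 * X 1 : MvPolynomial (Fin 3) ℂ) ∈ threeLinesIdeal :=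
    Ideal.subset_span (by simp)
  have h02 : (X 0 * X 2 : MvPolynomial (Fin 3) ℂ) ∈ threeLinesIdeal :=
    Ideal.subset_span (by simp)
  have h12 : (X 1 ^ 2 - X 2 ^ 2 : MvPolynomial (Fin 3) ℂ) ∈ threeLinesIdeal :=
    Ideal.subset_span (by simp)
  induction f using MvPolynomial.induction_on with
  | C a => exact ⟨0, Polynomial.C a, 0, by simp [algebraMap_eq]⟩
  | add p q hp hq =>
    obtain ⟨u, v, w, h⟩ := hp
    obtain ⟨u', v', w', h'⟩ := hq
    refine ⟨u + u', v + v', w + w', ?_⟩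
    convert add_mem h h' using 1
    simp only [map_add]
    ring
  | mul_X p i hp =>
    obtain ⟨u, v, w, h⟩ := hp
    have hpi := Ideal.mul_mem_right (X i) _ h
    fin_cases i
    · obtain ⟨v', hv'⟩ : ∃ v' : Polynomial ℂ, v = Polynomial.X * v' + Polynomial.C (v.coeff 0) :=
        ⟨_, (Polynomial.X_mul_divX_add v).symm⟩
      refine ⟨Polynomial.X * u + Polynomial.C (v.coeff 0), 0, 0, ?_⟩
      convert add_mem hpi (add_mem
        (Ideal.mul_mem_right (Polynomial.aeval (X 1) v') _ h01)
        (Ideal.mul_mem_right (Polynomial.aeval (X 1) w) _ h02)) using 1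
      rw [hv']
      simp [algebraMap_eq]
      ring
    · refine ⟨0, Polynomial.X * v, Polynomial.X * w, ?_⟩
      convert add_mem hpi (Ideal.mul_mem_right (Polynomial.aeval (X 0) u) _ h01) using 1
      simp
      ring
    · refine ⟨0, Polynomial.X ^ 2 * w, v, ?_⟩
      convert add_mem hpi (sub_mem (Ideal.mul_mem_right (Polynomial.aeval (X 0) u) _ h02)
        (Ideal.mul_mem_right (Polynomial.aeval (X 1) w) _ h12)) using 1
      simp
      ring

lemma Polynomial.eq_zero_of_eval_eq_zero_of_ne_zero {p : Polynomial ℂ}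
    (h : ∀ t : ℂ, t ≠ 0 → p.eval t = 0) : p = 0 :=
  p.eq_zero_of_infinite_isRoot
    ((Set.Finite.infinite_compl (Set.finite_singleton (0 : ℂ))).mono fun t ht => h t ht)

lemma eval_aeval_X {σ : Type*} (x : σ → ℂ) (i : σ) (p : Polynomial ℂ) :
    eval x (Polynomial.aeval (X i : MvPolynomial σ ℂ) p) = p.eval (x i) := by
  rw [← coe_aeval_eq_eval, RingHom.coe_coe, ← Polynomial.aeval_algHom_apply, aeval_X,
    Polynomial.coe_aeval_eq_eval]

lemma mem_threeLinesIdeal_of_eval_eq_zero {f : MvPolynomial (Fin 3) ℂ}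
    (hf : ∀ k, ∀ t : ℂ, t ≠ 0 → eval (t • lineDir k) f = 0) : f ∈ threeLinesIdeal := by
  obtain ⟨u, v, w, h⟩ := exists_normalForm_threeLines f
  have hle : threeLinesIdeal ≤ ⨅ k, ⨅ t : ℂ, RingHom.ker (eval (t • lineDir k)) := by
    refine Ideal.span_le.mpr ?_
    simp only [Set.insert_subset_iff, Set.singleton_subset_iff, SetLike.mem_coe,
      Ideal.mem_iInf, RingHom.mem_ker]
    refine ⟨?_, ?_, ?_⟩ <;> intro k t <;> fin_cases k <;> simp [lineDir]
  have key : ∀ k, ∀ t : ℂ, t ≠ 0 → eval (t • lineDir k) (X 0 * Polynomial.aeval (X 0) u +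
      Polynomial.aeval (X 1) v + X 2 * Polynomial.aeval (X 1) w) = 0 := by
    intro k t ht
    have h1 := hle h
    simp only [Ideal.mem_iInf, RingHom.mem_ker] at h1
    have h2 := h1 k t
    rwa [map_sub, hf k t ht, zero_sub, neg_eq_zero] at h2
  simp only [map_add, map_mul, eval_aeval_X, eval_X] at key
  have hplus : v + Polynomial.X * w = 0 :=
    Polynomial.eq_zero_of_eval_eq_zero_of_ne_zero fun t ht => by
      simpa [lineDir] using key 1 t ht
  have hminus : v - Polynomial.X * w = 0 :=
    Polynomial.eq_zero_of_eval_eq_zero_of_ne_zero fun t ht => by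
      simpa [lineDir, sub_eq_add_neg] using key 2 t ht
  have hv : v = 0 := by
    have : (2 : Polynomial ℂ) * v = 0 := by linear_combination hplus + hminus
    simpa using this
  have hw : w = 0 := by simpa [hv] using hplus
  have hu : u = 0 := by
    have : Polynomial.X * u = 0 :=
      Polynomial.eq_zero_of_eval_eq_zero_of_ne_zero fun t ht => by
        simpa [lineDir, hv, hw] using key 0 t ht
    simpa using this
  simpa [hu, hv, hw] using h

end ThreeLines

section Points

variable {n : ℕ}

/-- The quadric `X₁² − X₂² + ∑ εⱼ Yⱼ²`. -/
noncomputable def quadric (ε : Fin n → ℂ) : MvPolynomial (Fin 3 ⊕ Fin n) ℂ :=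
  X (Sum.inl 0) ^ 2 - X (Sum.inl 1) ^ 2 + ∑ j, C (ε j) * X (Sum.inr j) ^ 2

/-- The ideal generated by the products `YᵢYⱼ`, the equations of three lines in the
`X`-variables, and `quadric ε`. -/
noncomputable def pointsIdeal (ε : Fin n → ℂ) : Ideal (MvPolynomial (Fin 3 ⊕ Fin n) ℂ) :=
  Ideal.span
    ({p | ∃ i j : Fin n, i < j ∧ p = X (Sum.inr i) * X (Sum.inr j)} ∪
      {X (Sum.inl 0) * X (Sum.inl 1), X (Sum.inl 0) * X (Sum.inl 2),
        (X (Sum.inl 1)) ^ 2 - (X (Sum.inl 2)) ^ 2, quadric ε})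

variable (ε : Fin n → ℂ)

lemma X_inr_mul_X_inr_mem_pointsIdeal {i j : Fin n} (hij : i ≠ j) :
    X (Sum.inr i) * X (Sum.inr j) ∈ pointsIdeal ε := by
  rcases hij.lt_or_gt with h | h
  · exact Ideal.subset_span (Or.inl ⟨i, j, h, rfl⟩)
  · exact Ideal.subset_span (Or.inl ⟨j, i, h, mul_comm _ _⟩)

lemma quadric_mem_pointsIdeal : quadric ε ∈ pointsIdeal ε :=
  Ideal.subset_span (Or.inr (by simp))

lemma rename_mem_pointsIdeal {a : MvPolynomial (Fin 3) ℂ} (ha : a ∈ threeLinesIdeal) :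
    rename Sum.inl a ∈ pointsIdeal ε := by
  have : threeLinesIdeal ≤ (pointsIdeal ε).comap (rename Sum.inl) := by
    refine Ideal.span_le.mpr ?_
    simp only [Set.insert_subset_iff, Set.singleton_subset_iff, SetLike.mem_coe,
      Ideal.mem_comap, map_mul, map_sub, map_pow, rename_X]
    refine ⟨?_, ?_, ?_⟩ <;> exact Ideal.subset_span (Or.inr (by simp))
  exact this ha

/-- The polynomial `a + ∑ bⱼ Yⱼ + ∑ cⱼ Yⱼ²` with coefficients in the `X`-variables. -/
noncomputable def normalForm (a : MvPolynomial (Fin 3) ℂ) (b c : Fin n → MvPolynomial (Fin 3) ℂ) :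
    MvPolynomial (Fin 3 ⊕ Fin n) ℂ :=
  rename Sum.inl a + ∑ j, rename Sum.inl (b j) * X (Sum.inr j) +
    ∑ j, rename Sum.inl (c j) * X (Sum.inr j) ^ 2

lemma sum_mul_X_mul_X_sub_mem_pointsIdeal (g : Fin n → MvPolynomial (Fin 3 ⊕ Fin n) ℂ)
    (i : Fin n) :
    (∑ j, g j * X (Sum.inr j)) * X (Sum.inr i) - g i * X (Sum.inr i) ^ 2 ∈ pointsIdeal ε := by
  rw [← Finset.add_sum_erase _ _ (Finset.mem_univ i), add_mul, sq, mul_assoc, add_sub_cancel_left,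
    Finset.sum_mul]
  refine sum_mem fun j hj => ?_
  rw [mul_assoc]
  exact Ideal.mul_mem_left _ _
    (X_inr_mul_X_inr_mem_pointsIdeal ε (Finset.ne_of_mem_erase hj))

lemma exists_normalForm (hε : ∀ j, ε j ≠ 0) (f : MvPolynomial (Fin 3 ⊕ Fin n) ℂ) :
    ∃ a b c, f - normalForm a b c ∈ pointsIdeal ε := by
  induction f using MvPolynomial.induction_on with
  | C a => exact ⟨C a, 0, 0, by simp [normalForm]⟩
  | add p q hp hq =>
    obtain ⟨a, b, c, h⟩ := hp
    obtain ⟨a', b', c', h'⟩ := hq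
    refine ⟨a + a', b + b', c + c', ?_⟩
    convert add_mem h h' using 1
    simp only [normalForm, map_add, Pi.add_apply, add_mul, Finset.sum_add_distrib]
    ring
  | mul_X p i hp =>
    obtain ⟨a, b, c, h⟩ := hp
    have hpi := Ideal.mul_mem_right (X i) _ h
    rcases i with i | i
    · refine ⟨a * X i, fun j => b j * X i, fun j => c j * X i, ?_⟩
      convert hpi using 1
      simp only [normalForm, map_mul, rename_X, sub_mul, add_mul, Finset.sum_mul,
        mul_right_comm]
    · refine ⟨0, Pi.single i (a - C (ε i)⁻¹ * (X 0 ^ 2 - X 1 ^ 2) * c i), Pi.single i (b i), ?_⟩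
      have hb := sum_mul_X_mul_X_sub_mem_pointsIdeal ε (fun j => rename Sum.inl (b j)) i
      have hc := sum_mul_X_mul_X_sub_mem_pointsIdeal ε
        (fun j => rename Sum.inl (c j) * X (Sum.inr j)) i
      have hq := sum_mul_X_mul_X_sub_mem_pointsIdeal ε (fun j => C (ε j) * X (Sum.inr j)) i
      have hQ := Ideal.mul_mem_right (X (Sum.inr i)) _ (quadric_mem_pointsIdeal ε)
      have hcub := Ideal.mul_mem_left _ (rename Sum.inl (c i) * C (ε i)⁻¹) (sub_mem hQ hq)
      convert add_mem hpi (add_mem (add_mem hb hc) hcub) using 1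
      have hinv : (C (ε i)⁻¹ * C (ε i) : MvPolynomial (Fin 3 ⊕ Fin n) ℂ) = 1 := by
        rw [← C_mul, inv_mul_cancel₀ (hε i), C_1]
      have hsingle : ∀ (g : MvPolynomial (Fin 3) ℂ) (k : ℕ),
          ∑ j, rename Sum.inl ((Pi.single i g : Fin n → MvPolynomial (Fin 3) ℂ) j) *
            (X (Sum.inr j) : MvPolynomial (Fin 3 ⊕ Fin n) ℂ) ^ k =
          rename Sum.inl g * X (Sum.inr i) ^ k := by
        intro g k
        rw [Finset.sum_eq_single i (fun j _ hj => by simp [hj]) (by simp), Pi.single_eq_same]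
      have hsingle_one := fun g => hsingle g 1
      simp only [pow_one] at hsingle_one
      simp only [normalForm, hsingle, hsingle_one, quadric, map_sub, map_mul, map_pow, rename_X,
        rename_C, map_zero, mul_assoc, ← sq]
      linear_combination (-rename Sum.inl (c i) * X (Sum.inr i) ^ 3) * hinv

/-- Points on which the quadrics in `pointsIdeal` vanish, for a choice `r` of square roots. -/
def pointVec (r : Fin 3 → Fin n → ℂ) (k : Fin 3 × Fin n × ℤˣ) : Fin 3 ⊕ Fin n → ℂ :=
  Sum.elim (lineDir k.1) (Pi.single k.2.1 (((k.2.2 : ℤ) : ℂ) * r k.1 k.2.1))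

/-- The value of `X₂² − X₁²` at `lineDir`. -/
def lineSign : Fin 3 → ℂ := ![-1, 1, 1]

lemma lineDir_sq (k : Fin 3) : lineDir k 0 ^ 2 - lineDir k 1 ^ 2 = -lineSign k := by
  fin_cases k <;> simp [lineDir, lineSign]

lemma lineSign_ne_zero (k : Fin 3) : lineSign k ≠ 0 := by
  fin_cases k <;> simp [lineSign]

lemma lineSign_sq (k : Fin 3) : lineSign k ^ 2 = 1 := by
  fin_cases k <;> simp [lineSign]

lemma units_int_cast_sq (δ : ℤˣ) : (((δ : ℤ) : ℂ)) ^ 2 = 1 := by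
  rcases Int.units_eq_one_or δ with rfl | rfl <;> simp

variable {ε} {r : Fin 3 → Fin n → ℂ}

lemma smul_pointVec_comp_inl (c : ℂ) (k : Fin 3 × Fin n × ℤˣ) :
    (c • pointVec r k) ∘ Sum.inl = c • lineDir k.1 := by
  ext i
  simp [pointVec]

lemma pointVec_ne_zero (k : Fin 3 × Fin n × ℤˣ) : pointVec r k ≠ 0 := by
  intro h
  have h0 := congr_fun h (Sum.inl 0)
  have h1 := congr_fun h (Sum.inl 1)
  simp only [pointVec, Sum.elim_inl, Pi.zero_apply] at h0 h1
  have := lineDir_sq k.1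
  rw [h0, h1] at this
  exact lineSign_ne_zero k.1 (by linear_combination this)

lemma pointsIdeal_eval_eq_zero (hr : ∀ k j, ε j * r k j ^ 2 = lineSign k)
    {f : MvPolynomial (Fin 3 ⊕ Fin n) ℂ} (hf : f ∈ pointsIdeal ε) (k : Fin 3 × Fin n × ℤˣ)
    (c : ℂ) : eval (c • pointVec r k) f = 0 := by
  have hle : pointsIdeal ε ≤ RingHom.ker (eval (c • pointVec r k)) := by
    refine Ideal.span_le.mpr ?_
    obtain ⟨k, j, δ⟩ := k
    rintro p (⟨i, i', hlt, rfl⟩ | hp)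
    · simp only [SetLike.mem_coe, RingHom.mem_ker, map_mul, eval_X, pointVec, Pi.smul_apply,
        Sum.elim_inr, Pi.single_apply]
      split_ifs with h h' <;> simp
      exact absurd (h.trans h'.symm) hlt.ne
    · have hq : eval (c • pointVec r (k, j, δ)) (quadric ε) = 0 := by
        simp only [quadric, map_add, map_sub, map_pow, map_sum, map_mul, eval_C, eval_X, pointVec,
          Pi.smul_apply, Sum.elim_inr, Sum.elim_inl, smul_eq_mul]
        rw [Finset.sum_eq_single j (fun i _ hi => by simp [hi]) (by simp), Pi.single_eq_same]
        linear_combination c ^ 2 * lineDir_sq k + c ^ 2 * ε j * r k j ^ 2 * units_int_cast_sq δ +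
          c ^ 2 * hr k j
      simp only [Set.mem_insert_iff, Set.mem_singleton_iff] at hp
      rcases hp with rfl | rfl | rfl | rfl
      · fin_cases k <;> simp [pointVec, lineDir]
      · fin_cases k <;> simp [pointVec, lineDir]
      · fin_cases k <;> simp [pointVec, lineDir]
      · exact hq
  exact hle hf

lemma root_ne_zero (hr : ∀ k j, ε j * r k j ^ 2 = lineSign k) (k : Fin 3) (j : Fin n) :
    r k j ≠ 0 := by
  intro h
  have := hr k j
  rw [h] at this
  exact lineSign_ne_zero k (by linear_combination -this)

lemma eval_normalForm_smul_pointVec (a : MvPolynomial (Fin 3) ℂ)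
    (b c : Fin n → MvPolynomial (Fin 3) ℂ) (t : ℂ) (k : Fin 3) (j : Fin n) (δ : ℤˣ) :
    eval (t • pointVec r (k, j, δ)) (normalForm a b c) =
      eval (t • lineDir k) a + eval (t • lineDir k) (b j) * (t * ((δ : ℤ) * r k j)) +
        eval (t • lineDir k) (c j) * (t * r k j) ^ 2 := by
  simp only [normalForm, map_add, map_sum, map_mul, map_pow, eval_rename, smul_pointVec_comp_inl,
    eval_X]
  rw [Finset.sum_eq_single j (fun i _ hi => by simp [pointVec, hi]) (by simp),
    Finset.sum_eq_single j (fun i _ hi => by simp [pointVec, hi]) (by simp)]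
  simp only [pointVec, Pi.smul_apply, Sum.elim_inr, Pi.single_eq_same, smul_eq_mul]
  linear_combination eval (t • lineDir k) (c j) * (t * r k j) ^ 2 * units_int_cast_sq δ

lemma mem_pointsIdeal_iff (hε : ∀ j, ε j ≠ 0) (l : Fin n)
    (hr : ∀ k j, ε j * r k j ^ 2 = lineSign k) {f : MvPolynomial (Fin 3 ⊕ Fin n) ℂ} :
    f ∈ pointsIdeal ε ↔ ∀ k, ∀ c : ℂ, eval (c • pointVec r k) f = 0 := by
  refine ⟨fun h k c => pointsIdeal_eval_eq_zero hr h k c, fun hf => ?_⟩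
  obtain ⟨a, b, c, h⟩ := exists_normalForm ε hε f
  obtain ⟨a, c, hcl, h⟩ : ∃ a c, c l = 0 ∧ f - normalForm a b c ∈ pointsIdeal ε := by
    refine ⟨a - C (ε l)⁻¹ * (X 0 ^ 2 - X 1 ^ 2) * c l,
      fun j => c j - C (ε l)⁻¹ * C (ε j) * c l, ?_, ?_⟩
    · beta_reduce
      rw [← C_mul, inv_mul_cancel₀ (hε l), C_1, one_mul, sub_self]
    · convert add_mem h (Ideal.mul_mem_left _ (rename Sum.inl (C (ε l)⁻¹ * c l))
        (quadric_mem_pointsIdeal ε)) using 1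
      simp only [normalForm, quadric, map_sub, map_mul, map_pow, rename_C, rename_X, sub_mul,
        Finset.sum_sub_distrib, mul_add, Finset.mul_sum]
      have : ∑ j, C (ε l)⁻¹ * C (ε j) * rename Sum.inl (c l) *
          (X (Sum.inr j) : MvPolynomial (Fin 3 ⊕ Fin n) ℂ) ^ 2 =
          ∑ j, C (ε l)⁻¹ * rename Sum.inl (c l) * (C (ε j) * X (Sum.inr j) ^ 2) :=
        Finset.sum_congr rfl fun j _ => by ring
      rw [this]
      ring
  have hzero : ∀ k t j (δ : ℤˣ), eval (t • lineDir k) a +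
      eval (t • lineDir k) (b j) * (t * ((δ : ℤ) * r k j)) +
        eval (t • lineDir k) (c j) * (t * r k j) ^ 2 = 0 := by
    intro k t j δ
    rw [← eval_normalForm_smul_pointVec]
    have := pointsIdeal_eval_eq_zero hr h (k, j, δ) t
    rwa [map_sub, hf, zero_sub, neg_eq_zero] at this
  have hb : ∀ j, b j ∈ threeLinesIdeal := fun j => by
    refine mem_threeLinesIdeal_of_eval_eq_zero fun k t ht => ?_
    have h1 := hzero k t j 1
    have h2 := hzero k t j (-1)
    push_cast at h1 h2
    have : eval (t • lineDir k) (b j) * (t * r k j) = 0 := by linear_combination (h1 - h2) / 2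
    simpa [ht, root_ne_zero hr k j] using this
  have heven : ∀ k t j, eval (t • lineDir k) a +
      eval (t • lineDir k) (c j) * (t * r k j) ^ 2 = 0 := fun k t j => by
    have h1 := hzero k t j 1
    have h2 := hzero k t j (-1)
    push_cast at h1 h2
    linear_combination (h1 + h2) / 2
  have ha0 : ∀ k t, eval (t • lineDir k) a = 0 := fun k t => by
    simpa [hcl] using heven k t l
  have hc : ∀ j, c j ∈ threeLinesIdeal := fun j => by
    refine mem_threeLinesIdeal_of_eval_eq_zero fun k t ht => ?_
    simpa [ha0, ht, root_ne_zero hr k j] using heven k t j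
  have ha : a ∈ threeLinesIdeal := mem_threeLinesIdeal_of_eval_eq_zero fun k t _ => ha0 k t
  have hnf : normalForm a b c ∈ pointsIdeal ε :=
    add_mem (add_mem (rename_mem_pointsIdeal ε ha)
      (sum_mem fun j _ => Ideal.mul_mem_right _ _ (rename_mem_pointsIdeal ε (hb j))))
      (sum_mem fun j _ => Ideal.mul_mem_right _ _ (rename_mem_pointsIdeal ε (hc j)))
  simpa using add_mem h hnf

lemma pointVec_mk_injective (hr : ∀ k j, ε j * r k j ^ 2 = lineSign k) :
    Function.Injective fun k => Projectivization.mk ℂ (pointVec r k) (pointVec_ne_zero k) := by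
  rintro ⟨k, j, δ⟩ ⟨k', j', δ'⟩ h
  obtain ⟨a, ha⟩ := (Projectivization.mk_eq_mk_iff' ℂ _ _ _ _).mp h
  have hx : ∀ i, a * lineDir k' i = lineDir k i := fun i => congr_fun ha (Sum.inl i)
  obtain ⟨rfl, rfl⟩ : k = k' ∧ a = 1 := by
    have h0 := hx 0
    have h1 := hx 1
    have h2 := hx 2
    fin_cases k <;> fin_cases k' <;> simp [lineDir] at h0 h1 h2 ⊢ <;> grind
  rw [one_smul] at ha
  have hj := congr_fun ha (Sum.inr j)
  simp only [pointVec, Sum.elim_inr, Pi.single_eq_same, Pi.single_apply] at hj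
  have hr0 := root_ne_zero hr k j
  have hδ : ((δ : ℤ) : ℂ) ≠ 0 := by simp
  split_ifs at hj with hjj
  · subst hjj
    have := mul_right_cancel₀ hr0 hj
    rw [Int.cast_inj, Units.val_inj] at this
    rw [this]
  · exact absurd hj.symm (mul_ne_zero hδ hr0)

variable (n) in
/-- The form `(x₁² + x₂² + x₃²)(y₁² + ⋯ + yₙ²)`. -/
noncomputable def productForm : MvPolynomial (Fin 3 ⊕ Fin n) ℂ :=
  (∑ i, X (Sum.inl i) ^ 2) * ∑ j, X (Sum.inr j) ^ 2

lemma pderiv_inl_productForm (i : Fin 3) :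
    pderiv (Sum.inl i) (productForm n) = 2 * X (Sum.inl i) * ∑ j, X (Sum.inr j) ^ 2 := by
  simp only [productForm, Derivation.leibniz, Derivation.leibniz_pow, map_sum, pderiv_X,
    Pi.single_apply, reduceCtorEq, Sum.inl.injEq, smul_eq_mul, nsmul_eq_mul]
  simp
  ring

lemma pderiv_inr_productForm (j : Fin n) :
    pderiv (Sum.inr j) (productForm n) = 2 * X (Sum.inr j) * ∑ i : Fin 3, X (Sum.inl i) ^ 2 := by
  simp only [productForm, Derivation.leibniz, Derivation.leibniz_pow, map_sum, pderiv_X,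
    Pi.single_apply, reduceCtorEq, Sum.inr.injEq, smul_eq_mul, nsmul_eq_mul]
  simp
  ring

lemma apolar_X_inl_mul_X_inl (i k : Fin 3) :
    apolar (X (Sum.inl i) * X (Sum.inl k)) (productForm n) =
      if i = k then 2 * ∑ j, X (Sum.inr j) ^ 2 else 0 := by
  rw [apolar_X_mul_X, pderiv_inl_productForm,
    show (2 : MvPolynomial (Fin 3 ⊕ Fin n) ℂ) = C 2 from rfl, mul_assoc]
  rw [pderiv_C_mul]
  simp only [Derivation.leibniz, Derivation.leibniz_pow, map_sum, pderiv_X,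
    Pi.single_apply, reduceCtorEq, Sum.inl.injEq, smul_eq_mul, nsmul_eq_mul]
  rcases eq_or_ne i k with rfl | h
  · simp
  · simp [h, h.symm]

lemma apolar_X_inr_mul_X_inr (i k : Fin n) :
    apolar (X (Sum.inr i) * X (Sum.inr k)) (productForm n) =
      if i = k then 2 * ∑ j : Fin 3, X (Sum.inl j) ^ 2 else 0 := by
  rw [apolar_X_mul_X, pderiv_inr_productForm,
    show (2 : MvPolynomial (Fin 3 ⊕ Fin n) ℂ) = C 2 from rfl, mul_assoc]
  rw [pderiv_C_mul]
  simp only [Derivation.leibniz, Derivation.leibniz_pow, map_sum, pderiv_X,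
    Pi.single_apply, reduceCtorEq, Sum.inr.injEq, smul_eq_mul, nsmul_eq_mul]
  rcases eq_or_ne i k with rfl | h
  · simp
  · simp [h, h.symm]

lemma pointsIdeal_le_apolarIdeal (hsum : ∑ j, ε j = 0) :
    pointsIdeal ε ≤ apolarIdeal (productForm n) := by
  have hsub : ∀ g h : MvPolynomial (Fin 3 ⊕ Fin n) ℂ, apolar (g - h) (productForm n) =
      apolar g (productForm n) - apolar h (productForm n) :=
    fun g h => map_sub (apolarLinear (productForm n)) g h
  have hfs : ∀ g : Fin n → MvPolynomial (Fin 3 ⊕ Fin n) ℂ, apolar (∑ j, g j) (productForm n) =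
      ∑ j, apolar (g j) (productForm n) := fun g => map_sum (apolarLinear (productForm n)) g _
  refine Ideal.span_le.mpr ?_
  rintro p (⟨i, j, hij, rfl⟩ | hp)
  · rw [SetLike.mem_coe, mem_apolarIdeal, apolar_X_inr_mul_X_inr, if_neg hij.ne]
  · simp only [Set.mem_insert_iff, Set.mem_singleton_iff] at hp
    rw [SetLike.mem_coe, mem_apolarIdeal]
    rcases hp with rfl | rfl | rfl | rfl
    · simp [apolar_X_inl_mul_X_inl]
    · simp [apolar_X_inl_mul_X_inl]
    · simp [hsub, sq (X (Sum.inl _)), apolar_X_inl_mul_X_inl]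
    · simp only [quadric, apolar_add, hsub, hfs, C_mul', apolar_smul, sq (X _),
        apolar_X_inl_mul_X_inl, apolar_X_inr_mul_X_inr, if_true, sub_self, zero_add]
      rw [← Finset.sum_smul, hsum, zero_smul]

/-- Weights with `x₁² + x₂² + x₃² = ∑ mₖ (lineDirₖ · x)²`. -/
noncomputable def lineWeight : Fin 3 → ℂ := ![1, 1 / 2, 1 / 2]

lemma productForm_eq_sum_pow (hε : ∀ j, ε j ≠ 0) (hsum : ∑ j, ε j = 0)
    (hr : ∀ k j, ε j * r k j ^ 2 = lineSign k) :
    productForm n = ∑ k : Fin 3 × Fin n × ℤˣ,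
      C (lineWeight k.1 * lineSign k.1 * ε k.2.1 / 12) *
        (∑ s, C (pointVec r k s) * X s) ^ 4 := by
  set P : Fin 3 → MvPolynomial (Fin 3 ⊕ Fin n) ℂ := fun k =>
    ∑ i, C (lineDir k i) * X (Sum.inl i) with hP
  have hlin : ∀ k, (∑ s, C (pointVec r k s) * X s : MvPolynomial (Fin 3 ⊕ Fin n) ℂ) =
      P k.1 + C (((k.2.2 : ℤ) : ℂ) * r k.1 k.2.1) * X (Sum.inr k.2.1) := by
    intro k
    rw [Fintype.sum_sum_type]
    congr 1
    rw [Finset.sum_eq_single k.2.1 (fun i _ hi => by simp [pointVec, hi]) (by simp)]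
    simp [pointVec]
  have hterm : ∀ k j, ∑ δ : ℤˣ, C (lineWeight k * lineSign k * ε j / 12) *
      (P k + C (((δ : ℤ) : ℂ) * r k j) * X (Sum.inr j)) ^ 4 =
      C (lineWeight k * lineSign k / 6) * P k ^ 4 * C (ε j) +
        C (lineWeight k) * P k ^ 2 * X (Sum.inr j) ^ 2 +
        C (lineWeight k * lineSign k / 6) * (C (ε j)⁻¹ * X (Sum.inr j) ^ 4) := by
    intro k j
    have h1 : (C (lineWeight k * lineSign k * ε j / 12) : MvPolynomial (Fin 3 ⊕ Fin n) ℂ) * 2 =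
        C (lineWeight k * lineSign k / 6) * C (ε j) := by
      rw [show (2 : MvPolynomial (Fin 3 ⊕ Fin n) ℂ) = C 2 from rfl, ← C_mul, ← C_mul]
      congr 1
      ring
    have h2 : (C (lineWeight k * lineSign k * ε j / 12) : MvPolynomial (Fin 3 ⊕ Fin n) ℂ) * 12 *
        C (r k j) ^ 2 = C (lineWeight k) := by
      rw [show (12 : MvPolynomial (Fin 3 ⊕ Fin n) ℂ) = C 12 from rfl, ← C_pow, ← C_mul, ← C_mul]
      congr 1
      linear_combination lineWeight k * lineSign k * hr k j + lineWeight k * lineSign_sq k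
    have h3 : (C (lineWeight k * lineSign k * ε j / 12) : MvPolynomial (Fin 3 ⊕ Fin n) ℂ) * 2 *
        C (r k j) ^ 4 = C (lineWeight k * lineSign k / 6) * C (ε j)⁻¹ := by
      rw [show (2 : MvPolynomial (Fin 3 ⊕ Fin n) ℂ) = C 2 from rfl, ← C_pow, ← C_mul, ← C_mul,
        ← C_mul]
      congr 1
      have hr2 : r k j ^ 2 = lineSign k * (ε j)⁻¹ := by
        rw [← hr k j, mul_comm, inv_mul_cancel_left₀ (hε j)]
      rw [show r k j ^ 4 = (r k j ^ 2) ^ 2 by ring, hr2, mul_pow, lineSign_sq]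
      field_simp [hε j]
      ring
    rw [UnitsInt.univ, Finset.sum_insert (by decide), Finset.sum_singleton]
    simp only [Units.val_one, Units.val_neg, Int.cast_one, Int.cast_neg, one_mul, neg_mul, C_neg]
    linear_combination P k ^ 4 * h1 + P k ^ 2 * X (Sum.inr j) ^ 2 * h2 + X (Sum.inr j) ^ 4 * h3
  simp only [hlin, Fintype.sum_prod_type, hterm, Finset.sum_add_distrib, ← Finset.mul_sum]
  rw [← map_sum, hsum, ← Finset.sum_mul, ← Finset.sum_mul, ← Finset.sum_mul, ← map_sum, productForm]
  have hw : ∑ k, lineWeight k * lineSign k / 6 = 0 := by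
    simp [Fin.sum_univ_three, lineWeight, lineSign]
    norm_num
  have hhalf : (C (1 / 2) : MvPolynomial (Fin 3 ⊕ Fin n) ℂ) * 2 = 1 := by
    rw [show (2 : MvPolynomial (Fin 3 ⊕ Fin n) ℂ) = C 2 from rfl, ← C_mul]
    norm_num
  have hquad : ∑ k, C (lineWeight k) * P k ^ 2 =
      ∑ i, (X (Sum.inl i) : MvPolynomial (Fin 3 ⊕ Fin n) ℂ) ^ 2 := by
    simp only [hP, Fin.sum_univ_three, lineWeight, lineDir, Matrix.cons_val, C_0, C_1, C_neg]
    linear_combination (X (Sum.inl 1) ^ 2 + X (Sum.inl 2) ^ 2) * hhalf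
  rw [hw, hquad]
  simp

lemma card_signedPoints : Fintype.card (Fin 3 × Fin n × ℤˣ) = 6 * n := by
  simp only [Fintype.card_prod, Fintype.card_fin, Fintype.card_units_int]
  ring

lemma waringRank_productForm_le (hε : ∀ j, ε j ≠ 0) (hsum : ∑ j, ε j = 0)
    (hr : ∀ k j, ε j * r k j ^ 2 = lineSign k) : waringRank 4 (productForm n) ≤ 6 * n := by
  let e := (Fintype.equivFinOfCardEq (card_signedPoints (n := n))).symm
  refine Nat.sInf_le ⟨fun i => lineWeight (e i).1 * lineSign (e i).1 * ε (e i).2.1 / 12,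
    fun i => pointVec r (e i), ?_⟩
  rw [productForm_eq_sum_pow hε hsum hr]
  exact (Equiv.sum_comp e _).symm

lemma exists_finset_pointsIdeal_eq (hε : ∀ j, ε j ≠ 0) (l : Fin n)
    (hr : ∀ k j, ε j * r k j ^ 2 = lineSign k) :
    ∃ S : Finset (Projectivization ℂ ((Fin 3 ⊕ Fin n) → ℂ)),
      S.card = 6 * n ∧ pointsIdeal ε = projVanishingIdeal ↑S := by
  refine ⟨Finset.univ.map ⟨_, pointVec_mk_injective hr⟩, ?_, ?_⟩
  · rw [Finset.card_map, Finset.card_univ, card_signedPoints]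
  · rw [Finset.coe_map, Finset.coe_univ, Set.image_univ]
    ext f
    rw [mem_pointsIdeal_iff hε l hr]
    exact (mem_projVanishingIdeal_range _ pointVec_ne_zero).symm

end Points

/-- For `n ≥ 2` and `F = (x_1^2+x_2^2+x_3^2)(y_1^2 + ⋯ + y_n^2)`, `rk F ≤ 6n`: the ideal
`I = ({Y_iY_j}_{i<j}, X_1X_2, X_1X_3, X_2^2 − X_3^2,
X_1^2 − X_2^2 + Y_1^2 + ⋯ + Y_{n-1}^2 − (n−1)Y_n^2)` is contained in `F^⊥` and is the
(radical) vanishing ideal of `6n` distinct points of `ℙ^{n+2}`. -/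
theorem statement13 (n : ℕ) (hn : 2 ≤ n) :
    let Y : Fin n → MvPolynomial (Fin 3 ⊕ Fin n) ℂ := fun j => X (Sum.inr j)
    let F : MvPolynomial (Fin 3 ⊕ Fin n) ℂ :=
      (∑ i, (X (Sum.inl i)) ^ 2) * ∑ j, (Y j) ^ 2
    let I : Ideal (MvPolynomial (Fin 3 ⊕ Fin n) ℂ) := Ideal.span
      ({p | ∃ i j : Fin n, i < j ∧ p = Y i * Y j} ∪
       {X (Sum.inl 0) * X (Sum.inl 1), X (Sum.inl 0) * X (Sum.inl 2),
        (X (Sum.inl 1)) ^ 2 - (X (Sum.inl 2)) ^ 2,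
        (X (Sum.inl 0)) ^ 2 - (X (Sum.inl 1)) ^ 2 +
          (∑ j ∈ Finset.univ.erase (⟨n - 1, by omega⟩ : Fin n), (Y j) ^ 2) -
          C ((n : ℂ) - 1) * (Y ⟨n - 1, by omega⟩) ^ 2})
    waringRank 4 F ≤ 6 * n ∧ (∀ g ∈ I, apolar g F = 0) ∧
    (∃ 𝕏 : Finset (Projectivization ℂ ((Fin 3 ⊕ Fin n) → ℂ)),
      𝕏.card = 6 * n ∧ I = projVanishingIdeal ↑𝕏) := by
  intro Y F I
  set l : Fin n := ⟨n - 1, by omega⟩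
  set ε : Fin n → ℂ := fun j => if j = l then -((n : ℂ) - 1) else 1 with hεdef
  have hn1 : (n : ℂ) - 1 ≠ 0 := by
    rw [sub_ne_zero]
    exact_mod_cast (by omega : n ≠ 1)
  have hε : ∀ j, ε j ≠ 0 := by
    intro j
    simp only [hεdef]
    split_ifs
    exacts [neg_ne_zero.mpr hn1, one_ne_zero]
  have herase : ∀ j ∈ Finset.univ.erase l, ε j = 1 := fun j hj =>
    if_neg (Finset.ne_of_mem_erase hj)
  have hεl : ε l = -((n : ℂ) - 1) := if_pos rfl
  have hsum : ∑ j, ε j = 0 := by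
    rw [← Finset.add_sum_erase _ _ (Finset.mem_univ l), Finset.sum_congr rfl herase, hεl,
      Finset.sum_const, Finset.card_erase_of_mem (Finset.mem_univ l), Finset.card_univ,
      Fintype.card_fin, nsmul_eq_mul, Nat.cast_sub (by omega : 1 ≤ n)]
    push_cast
    ring
  have hr : ∀ k j, ∃ z : ℂ, ε j * z ^ 2 = lineSign k := fun k j => by
    obtain ⟨z, hz⟩ := IsAlgClosed.exists_pow_nat_eq (lineSign k / ε j) (n := 2) (by norm_num)
    exact ⟨z, by rw [hz, mul_div_cancel₀ _ (hε j)]⟩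
  choose r hr using hr
  have hquadric : X (Sum.inl 0) ^ 2 - X (Sum.inl 1) ^ 2 + (∑ j ∈ Finset.univ.erase l, Y j ^ 2) -
      C ((n : ℂ) - 1) * Y l ^ 2 = quadric ε := by
    have hsq : ∑ j ∈ Finset.univ.erase l, C (ε j) * X (Sum.inr j) ^ 2 =
        ∑ j ∈ Finset.univ.erase l, Y j ^ 2 :=
      Finset.sum_congr rfl fun j hj => by rw [herase j hj, C_1, one_mul]
    rw [quadric, ← Finset.add_sum_erase _ _ (Finset.mem_univ l), hεl, C_neg, hsq]
    ring
  have hI : I = pointsIdeal ε := by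
    rw [pointsIdeal, ← hquadric]
  rw [hI]
  exact ⟨waringRank_productForm_le hε hsum hr,
    fun g hg => mem_apolarIdeal.mp (pointsIdeal_le_apolarIdeal hsum hg),
    exists_finset_pointsIdeal_eq hε l hr⟩
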